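/- arXiv:2506.12718 — 5 statements merged into one kernel-verified Lean document; each statement's English description precedes it below -/
import Mathlib

section
/- Let n₁, n₂ ≥ 1 and let F_{n₁}, F_{n₂} be the DFT matrices of sizes n₁ and n₂, with inverses F_{n_q}⁻¹ = (1/n_q) • conj(F_{n_q}). Then for all n₁×n₂ complex matrices G and X: vec( F_{n₁}⁻¹ · (G ∘ (F_{n₁} · X · F_{n₂})) · F_{n₂}⁻¹ ) = (F_{n₂}⁻¹ ⊗ F_{n₁}⁻¹) · diag(vec(G)) · (F_{n₂} ⊗ F_{n₁}) · vec(X), where ∘ on matrices is the entrywise (Hadamard) product. -/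
open Matrix Kronecker Complex

/-- The primitive root `ω_n = exp(−2πi/n)`. -/
noncomputable def ω (n : ℕ) : ℂ := Complex.exp (-(2 * Real.pi * Complex.I) / n)

/-- The `n × n` DFT matrix with 0-based entries `(F_n)_{jk} = ω_n^{j·k}`. -/
noncomputable def dftMatrix (n : ℕ) : Matrix (Fin n) (Fin n) ℂ :=
  fun j k => ω n ^ (j.val * k.val)

/-- Vectorization of an `n₁ × n₂` matrix: the vector indexed by pairs `(j,i)` with
`vec(X)_{(j,i)} = X_{i j}`. -/
def vecOf {n₁ n₂ : ℕ} (X : Matrix (Fin n₁) (Fin n₂) ℂ) : Fin n₂ × Fin n₁ → ℂ :=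
  fun p => X p.2 p.1

theorem dftMatrix_transpose (n : ℕ) : (dftMatrix n)ᵀ = dftMatrix n := by
  ext j k
  simp [dftMatrix, mul_comm]

theorem dftMatrix_inv_transpose (n : ℕ) : ((dftMatrix n)⁻¹)ᵀ = (dftMatrix n)⁻¹ := by
  rw [Matrix.transpose_nonsing_inv, dftMatrix_transpose]

theorem kronecker_mulVec_vecOf {n₁ n₂ : ℕ} (A : Matrix (Fin n₂) (Fin n₂) ℂ)
    (B : Matrix (Fin n₁) (Fin n₁) ℂ) (X : Matrix (Fin n₁) (Fin n₂) ℂ) :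
    (A ⊗ₖ B).mulVec (vecOf X) = vecOf (B * X * Aᵀ) :=
  Matrix.kronecker_mulVec_vec B X A

theorem diagonal_vecOf_mulVec_vecOf {n₁ n₂ : ℕ} (G X : Matrix (Fin n₁) (Fin n₂) ℂ) :
    (Matrix.diagonal (vecOf G)).mulVec (vecOf X) = vecOf (G ⊙ X) := by
  ext p
  simp [Matrix.mulVec_diagonal, vecOf]

/-- Vectorized form of the 2D FFT-based convolution:
`vec(F₁⁻¹ · (G ∘ (F₁·X·F₂)) · F₂⁻¹) = (F₂⁻¹ ⊗ F₁⁻¹) · diag(vec G) · (F₂ ⊗ F₁) · vec X`. -/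
theorem stmt4 (n₁ n₂ : ℕ) (hn₁ : 1 ≤ n₁) (hn₂ : 1 ≤ n₂)
    (G X : Matrix (Fin n₁) (Fin n₂) ℂ) :
    vecOf ((dftMatrix n₁)⁻¹ *
        (G ⊙ (dftMatrix n₁ * X * dftMatrix n₂)) * (dftMatrix n₂)⁻¹)
      = (((dftMatrix n₂)⁻¹ ⊗ₖ (dftMatrix n₁)⁻¹) *
          Matrix.diagonal (vecOf G) *
          (dftMatrix n₂ ⊗ₖ dftMatrix n₁)).mulVec (vecOf X) := by
  rw [← Matrix.mulVec_mulVec, ← Matrix.mulVec_mulVec, kronecker_mulVec_vecOf,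
    diagonal_vecOf_mulVec_vecOf, kronecker_mulVec_vecOf, dftMatrix_transpose,
    dftMatrix_inv_transpose]
end

section
/- Let n₁, n₂ ≥ 1, and suppose for q = 1, 2 that F_{n_q} = A_q · P_q with A_q an n_q×n_q complex matrix and P_q a symmetric permutation matrix. Then for every vector g indexed by pairs (j,i) with j < n₂, i < n₁, and every such vector v: (conj(F_{n₂}) ⊗ conj(F_{n₁})) · (g ∘ ((F_{n₂} ⊗ F_{n₁}) · v)) = (conj(A₂) ⊗ conj(A₁)) · (ĝ ∘ ((A₂ᵀ ⊗ A₁ᵀ) · v)), where ĝ := (P₂ ⊗ P₁) · g. Dividing both sides by n₁·n₂ identifies the left-hand side with the vectorized two-dimensional discrete convolution (F_{n₂}⁻¹ ⊗ F_{n₁}⁻¹) · diag(g) · (F_{n₂} ⊗ F_{n₁}) · v. -/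
open Matrix Kronecker Complex

theorem isPrimitiveRoot_ω {n : ℕ} (hn : n ≠ 0) : IsPrimitiveRoot (ω n) n := by
  have h : ω n = (Complex.exp (2 * Real.pi * Complex.I / n))⁻¹ := by
    rw [ω, ← Complex.exp_neg, neg_div]
  rw [h]
  exact (Complex.isPrimitiveRoot_exp n hn).inv

theorem conj_ω (n : ℕ) : (starRingEnd ℂ) (ω n) = (ω n)⁻¹ := by
  rw [ω, ← Complex.exp_conj, ← Complex.exp_neg]
  simp [neg_div, Complex.conj_ofNat]

theorem conj_dftMatrix_mul_dftMatrix {n : ℕ} (hn : n ≠ 0) :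
    (dftMatrix n).map (starRingEnd ℂ) * dftMatrix n = (n : ℂ) • 1 := by
  have hω := isPrimitiveRoot_ω hn
  have hω0 : ω n ≠ 0 := hω.ne_zero hn
  ext j l
  have hsum : ((dftMatrix n).map (starRingEnd ℂ) * dftMatrix n) j l
      = ∑ k ∈ Finset.range n, (ω n ^ l.val / ω n ^ j.val) ^ k := by
    rw [Matrix.mul_apply, ← Fin.sum_univ_eq_sum_range
      (fun k => (ω n ^ l.val / ω n ^ j.val) ^ k)]
    refine Finset.sum_congr rfl fun k _ => ?_
    simp only [dftMatrix, Matrix.map_apply, map_pow, conj_ω]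
    rw [div_pow, ← pow_mul, ← pow_mul, inv_pow, mul_comm k.val l.val, div_eq_inv_mul]
  rw [hsum, Matrix.smul_apply, Matrix.one_apply]
  split_ifs with h
  · subst h
    rw [div_self (pow_ne_zero _ hω0)]
    simp
  · have hne : ω n ^ l.val / ω n ^ j.val ≠ 1 := by
      rw [Ne, div_eq_one_iff_eq (pow_ne_zero _ hω0)]
      exact fun h' => h (Fin.ext (hω.pow_inj l.isLt j.isLt h').symm)
    rw [geom_sum_eq hne, div_pow, ← pow_mul, ← pow_mul, mul_comm l.val, mul_comm j.val,
      pow_mul, pow_mul, hω.pow_eq_one]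
    simp

theorem inv_dftMatrix {n : ℕ} (hn : n ≠ 0) :
    (dftMatrix n)⁻¹ = (n : ℂ)⁻¹ • (dftMatrix n).map (starRingEnd ℂ) := by
  apply Matrix.inv_eq_left_inv
  rw [Matrix.smul_mul, conj_dftMatrix_mul_dftMatrix hn, smul_smul,
    inv_mul_cancel₀ (Nat.cast_ne_zero.mpr hn), one_smul]

section SymmetricPermutation

variable {ι : Type*} [DecidableEq ι] {P : Matrix ι ι ℂ} {σ : Equiv.Perm ι}

theorem apply_apply_of_symm_perm (hP : ∀ j k, P j k = if j = σ k then 1 else 0)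
    (hPsym : P = Pᵀ) (k : ι) : σ (σ k) = k := by
  have h : P k (σ k) = P (σ k) k := congrFun (congrFun hPsym k) (σ k)
  rw [hP, hP, if_pos rfl] at h
  by_contra hk
  rw [if_neg (Ne.symm hk)] at h
  exact zero_ne_one h

theorem symm_perm_mulVec [Fintype ι] (hP : ∀ j k, P j k = if j = σ k then 1 else 0)
    (hPsym : P = Pᵀ) (w : ι → ℂ) : P.mulVec w = w ∘ σ := by
  ext j
  have h (k : ι) : P j k = if k = σ j then 1 else 0 :=
    (congrFun (congrFun hPsym j) k).trans (hP k j)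
  simp [Matrix.mulVec, dotProduct, h]

theorem symm_perm_mulVec_mul_mulVec [Fintype ι]
    (hP : ∀ j k, P j k = if j = σ k then 1 else 0) (hPsym : P = Pᵀ) (g w : ι → ℂ) :
    P.mulVec (fun p => g p * P.mulVec w p) = fun p => P.mulVec g p * w p := by
  ext p
  simp [symm_perm_mulVec hP hPsym, apply_apply_of_symm_perm hP hPsym]

theorem map_conj_perm (hP : ∀ j k, P j k = if j = σ k then 1 else 0) :
    P.map (starRingEnd ℂ) = P := by
  ext j k
  simp [hP, apply_ite]

end SymmetricPermutation

theorem kronecker_perm_apply {ι κ : Type*} [DecidableEq ι] [DecidableEq κ]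
    {P : Matrix ι ι ℂ} {Q : Matrix κ κ ℂ} {σ : Equiv.Perm ι} {τ : Equiv.Perm κ}
    (hP : ∀ j k, P j k = if j = σ k then 1 else 0)
    (hQ : ∀ j k, Q j k = if j = τ k then 1 else 0) (p q : ι × κ) :
    (P ⊗ₖ Q) p q = if p = σ.prodCongr τ q then 1 else 0 := by
  obtain ⟨a, b⟩ := p
  obtain ⟨c, d⟩ := q
  simp [hP, hQ, ← ite_and, and_comm]

/-- Permutation-avoiding 2D convolution: if `F_{n_q} = A_q · P_q` with `P_q` symmetric
permutation matrices, then
`(conj F₂ ⊗ conj F₁) · (g ∘ ((F₂ ⊗ F₁)·v)) = (conj A₂ ⊗ conj A₁) · (ghat ∘ ((A₂ᵀ ⊗ A₁ᵀ)·v))`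
with `ghat = (P₂ ⊗ P₁)·g`; dividing by `n₁·n₂` identifies the left-hand side with the
vectorized 2D discrete convolution `(F₂⁻¹ ⊗ F₁⁻¹) · diag(g) · (F₂ ⊗ F₁) · v`. -/
theorem stmt6 (n₁ n₂ : ℕ) (hn₁ : 1 ≤ n₁) (hn₂ : 1 ≤ n₂)
    (A₁ P₁ : Matrix (Fin n₁) (Fin n₁) ℂ) (σ₁ : Equiv.Perm (Fin n₁))
    (hP₁ : ∀ j k, P₁ j k = if j = σ₁ k then 1 else 0) (hP₁sym : P₁ = P₁ᵀ)
    (A₂ P₂ : Matrix (Fin n₂) (Fin n₂) ℂ) (σ₂ : Equiv.Perm (Fin n₂))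
    (hP₂ : ∀ j k, P₂ j k = if j = σ₂ k then 1 else 0) (hP₂sym : P₂ = P₂ᵀ)
    (hF₁ : dftMatrix n₁ = A₁ * P₁)
    (hF₂ : dftMatrix n₂ = A₂ * P₂)
    (g v : Fin n₂ × Fin n₁ → ℂ)
    (ghat : Fin n₂ × Fin n₁ → ℂ) (hghat : ghat = (P₂ ⊗ₖ P₁).mulVec g) :
    ((dftMatrix n₂).map (starRingEnd ℂ) ⊗ₖ (dftMatrix n₁).map (starRingEnd ℂ)).mulVec
        (fun p => g p * (dftMatrix n₂ ⊗ₖ dftMatrix n₁).mulVec v p)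
      = (A₂.map (starRingEnd ℂ) ⊗ₖ A₁.map (starRingEnd ℂ)).mulVec
          (fun p => ghat p * (A₂ᵀ ⊗ₖ A₁ᵀ).mulVec v p) ∧
    (((dftMatrix n₂)⁻¹ ⊗ₖ (dftMatrix n₁)⁻¹) * Matrix.diagonal g *
        (dftMatrix n₂ ⊗ₖ dftMatrix n₁)).mulVec v
      = ((1 : ℂ) / ((n₁ : ℂ) * (n₂ : ℂ))) •
          (A₂.map (starRingEnd ℂ) ⊗ₖ A₁.map (starRingEnd ℂ)).mulVec
            (fun p => ghat p * (A₂ᵀ ⊗ₖ A₁ᵀ).mulVec v p) := by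
  have hT₁ : dftMatrix n₁ = P₁ * A₁ᵀ := by
    rw [← dftMatrix_transpose, hF₁, Matrix.transpose_mul, ← hP₁sym]
  have hT₂ : dftMatrix n₂ = P₂ * A₂ᵀ := by
    rw [← dftMatrix_transpose, hF₂, Matrix.transpose_mul, ← hP₂sym]
  have hC₁ : (dftMatrix n₁).map (starRingEnd ℂ) = A₁.map (starRingEnd ℂ) * P₁ := by
    rw [hF₁, Matrix.map_mul, map_conj_perm hP₁]
  have hC₂ : (dftMatrix n₂).map (starRingEnd ℂ) = A₂.map (starRingEnd ℂ) * P₂ := by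
    rw [hF₂, Matrix.map_mul, map_conj_perm hP₂]
  have hsym : P₂ ⊗ₖ P₁ = (P₂ ⊗ₖ P₁)ᵀ := by
    rw [← Matrix.kroneckerMap_transpose, ← hP₁sym, ← hP₂sym]
  have hmain : ((dftMatrix n₂).map (starRingEnd ℂ) ⊗ₖ
        (dftMatrix n₁).map (starRingEnd ℂ)).mulVec
          (fun p => g p * (dftMatrix n₂ ⊗ₖ dftMatrix n₁).mulVec v p)
      = (A₂.map (starRingEnd ℂ) ⊗ₖ A₁.map (starRingEnd ℂ)).mulVec
          (fun p => ghat p * (A₂ᵀ ⊗ₖ A₁ᵀ).mulVec v p) := by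
    rw [hC₁, hC₂, hT₁, hT₂, Matrix.mul_kronecker_mul, Matrix.mul_kronecker_mul,
      ← Matrix.mulVec_mulVec, ← Matrix.mulVec_mulVec,
      symm_perm_mulVec_mul_mulVec (kronecker_perm_apply hP₂ hP₁) hsym, hghat]
  refine ⟨hmain, ?_⟩
  have hdiag : (Matrix.diagonal g).mulVec ((dftMatrix n₂ ⊗ₖ dftMatrix n₁).mulVec v)
      = fun p => g p * (dftMatrix n₂ ⊗ₖ dftMatrix n₁).mulVec v p :=
    funext fun p => Matrix.mulVec_diagonal _ _ p
  rw [← hmain, ← Matrix.mulVec_mulVec, ← Matrix.mulVec_mulVec, hdiag,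
    inv_dftMatrix (Nat.one_le_iff_ne_zero.mp hn₁),
    inv_dftMatrix (Nat.one_le_iff_ne_zero.mp hn₂), Matrix.smul_kronecker,
    Matrix.kronecker_smul, smul_smul, Matrix.smul_mulVec, one_div, mul_inv,
    mul_comm (n₂ : ℂ)⁻¹]
end

section
/- Radix splitting of the DFT: let r, m ≥ 1 and n = r·m. Then for every x ∈ ℂⁿ (0-based indices) and all 0 ≤ i < m, 0 ≤ k < r: (F_n · x)(i + m·k) = Σ_{j=0}^{r−1} ω_n^{i·j} · ω_r^{j·k} · ( Σ_{l=0}^{m−1} ω_m^{i·l} · x(j + r·l) ). -/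
open Matrix Complex

/-- The index `i + m·k` of `{0,…,r·m−1}`, for `i < m` and `k < r`. -/
def idxOut (r m : ℕ) (i : Fin m) (k : Fin r) : Fin (r * m) :=
  ⟨i.val + m * k.val, by
    have h1 : i.val + m * k.val < m * (k.val + 1) := by
      rw [Nat.mul_succ]; have := i.isLt; omega
    have h2 : m * (k.val + 1) ≤ m * r :=
      Nat.mul_le_mul (Nat.le_refl m) (by have := k.isLt; omega)
    calc i.val + m * k.val < m * (k.val + 1) := h1
      _ ≤ m * r := h2
      _ = r * m := Nat.mul_comm m r⟩

/-- The index `j + r·l` of `{0,…,r·m−1}`, for `j < r` and `l < m`. -/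
def idxIn (r m : ℕ) (j : Fin r) (l : Fin m) : Fin (r * m) :=
  ⟨j.val + r * l.val, by
    have h1 : j.val + r * l.val < r * (l.val + 1) := by
      rw [Nat.mul_succ]; have := j.isLt; omega
    have h2 : r * (l.val + 1) ≤ r * m :=
      Nat.mul_le_mul (Nat.le_refl r) (by have := l.isLt; omega)
    exact lt_of_lt_of_le h1 h2⟩

lemma omega_mul_pow_left {r : ℕ} (hr : r ≠ 0) (m : ℕ) : ω (r * m) ^ r = ω m := by
  have hr' : (r : ℂ) ≠ 0 := Nat.cast_ne_zero.mpr hr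
  rw [ω, ω, ← Complex.exp_nat_mul, Nat.cast_mul, mul_div_assoc', mul_div_mul_left _ _ hr']

lemma omega_mul_pow_right (r : ℕ) {m : ℕ} (hm : m ≠ 0) : ω (r * m) ^ m = ω r := by
  rw [mul_comm, omega_mul_pow_left hm]

lemma omega_pow_self {n : ℕ} (hn : n ≠ 0) : ω n ^ n = 1 := by
  have h := omega_mul_pow_left hn 1
  rw [mul_one] at h
  rw [h, ω, Nat.cast_one, div_one, Complex.exp_neg, Complex.exp_two_pi_mul_I, inv_one]

/-- The equivalence `(l, j) ↦ j + r·l`. -/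
def idxInEquiv (r m : ℕ) : Fin m × Fin r ≃ Fin (r * m) :=
  finProdFinEquiv.trans (finCongr (Nat.mul_comm m r))

lemma idxInEquiv_apply (r m : ℕ) (p : Fin m × Fin r) :
    idxInEquiv r m p = idxIn r m p.2 p.1 := rfl

lemma sum_idxIn {M : Type*} [AddCommMonoid M] (r m : ℕ) (f : Fin (r * m) → M) :
    ∑ t, f t = ∑ j : Fin r, ∑ l : Fin m, f (idxIn r m j l) := by
  rw [← (idxInEquiv r m).sum_comp, Fintype.sum_prod_type_right]
  simp only [idxInEquiv_apply]

lemma omega_pow_split {r m : ℕ} (hr : r ≠ 0) (hm : m ≠ 0) (i j k l : ℕ) :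
    ω (r * m) ^ ((i + m * k) * (j + r * l))
      = ω (r * m) ^ (i * j) * ω r ^ (j * k) * ω m ^ (i * l) := by
  have hexp : (i + m * k) * (j + r * l)
      = i * j + m * (j * k) + r * (i * l) + r * m * (k * l) := by ring
  rw [hexp, pow_add, pow_add, pow_add, pow_mul _ m, pow_mul _ r, pow_mul _ (r * m),
    omega_mul_pow_left hr, omega_mul_pow_right r hm, omega_pow_self (mul_ne_zero hr hm),
    one_pow, mul_one]

/-- Radix splitting of the DFT: for `n = r·m`, `i < m` and `k < r`,
`(F_n·x)(i + m·k) = Σ_{j<r} ω_n^{i·j} ω_r^{j·k} (Σ_{l<m} ω_m^{i·l} x(j + r·l))`. -/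
theorem stmt10 (r m : ℕ) (hr : 1 ≤ r) (hm : 1 ≤ m)
    (x : Fin (r * m) → ℂ) (i : Fin m) (k : Fin r) :
    (dftMatrix (r * m)).mulVec x (idxOut r m i k)
      = ∑ j : Fin r, ω (r * m) ^ (i.val * j.val) * ω r ^ (j.val * k.val) *
          ∑ l : Fin m, ω m ^ (i.val * l.val) * x (idxIn r m j l) := by
  simp only [mulVec, dotProduct, sum_idxIn, Finset.mul_sum]
  refine Finset.sum_congr rfl fun j _ => Finset.sum_congr rfl fun l _ => ?_
  rw [← mul_assoc, ← omega_pow_split (by omega) (by omega)]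
  rfl
end

section
/- Good–Thomas (prime factor) index mapping: let n₁, n₂ ≥ 1 be coprime and n = n₁·n₂. Define π, ρ : {0,…,n₁−1}×{0,…,n₂−1} → {0,…,n−1} by π(j₁,j₂) = (j₁·n₂ + j₂·n₁) mod n, and ρ(k₁,k₂) = the unique k < n with k ≡ k₁ (mod n₁) and k ≡ k₂ (mod n₂). Then π and ρ are bijections, and for all j₁, k₁ < n₁ and j₂, k₂ < n₂: ω_n^{π(j₁,j₂)·ρ(k₁,k₂)} = ω_{n₁}^{j₁·k₁} · ω_{n₂}^{j₂·k₂}. Consequently there exist permutation matrices Γ, Υ on {0,…,n−1} such that F_n = Γ · (F_{n₂} ⊗ F_{n₁}) · Υᵀ. -/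
open Matrix Complex

/-- The permutation matrix of `σ`, with entries `P_{jk} = 1` if `j = σ k` and `0` otherwise. -/
def permMat {n : ℕ} (σ : Equiv.Perm (Fin n)) : Matrix (Fin n) (Fin n) ℂ :=
  fun j k => if j = σ k then 1 else 0

/-- The Kronecker product `M ⊗ N` of an `n₂ × n₂` matrix and an `n₁ × n₁` matrix, realized
on `{0,…,n−1}` via a bijection `e` with the pairs `(j,i)`, `j < n₂`, `i < n₁`. -/
noncomputable def kronE {n n₁ n₂ : ℕ} (e : Fin n ≃ Fin n₂ × Fin n₁)
    (M : Matrix (Fin n₂) (Fin n₂) ℂ) (N : Matrix (Fin n₁) (Fin n₁) ℂ) :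
    Matrix (Fin n) (Fin n) ℂ :=
  fun j k => M (e j).1 (e k).1 * N (e j).2 (e k).2

theorem ω_pow_self (n : ℕ) (hn : n ≠ 0) : ω n ^ n = 1 := by
  have hn' : (n : ℂ) ≠ 0 := Nat.cast_ne_zero.mpr hn
  rw [ω, ← Complex.exp_nat_mul, mul_div_cancel₀ _ hn', Complex.exp_neg,
    Complex.exp_two_pi_mul_I, inv_one]

theorem ω_mul_pow_right (m n : ℕ) (hn : n ≠ 0) : ω (m * n) ^ n = ω m := by
  have hn' : (n : ℂ) ≠ 0 := Nat.cast_ne_zero.mpr hn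
  rw [ω, ω, ← Complex.exp_nat_mul]
  congr 1
  push_cast
  rw [mul_comm (m : ℂ), mul_div_assoc', mul_div_mul_left _ _ hn']

theorem ω_mul_pow_left (m n : ℕ) (hm : m ≠ 0) : ω (m * n) ^ m = ω n := by
  rw [mul_comm, ω_mul_pow_right n m hm]

theorem ω_pow_congr {n a b : ℕ} (hn : n ≠ 0) (h : a ≡ b [MOD n]) : ω n ^ a = ω n ^ b := by
  rw [pow_eq_pow_mod a (ω_pow_self n hn), pow_eq_pow_mod b (ω_pow_self n hn), h]

theorem ω_mul_pow_good_thomas {m n : ℕ} (hm : m ≠ 0) (hn : n ≠ 0) {a k i j k₁ k₂ : ℕ}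
    (ha : a ≡ i * n + j * m [MOD m * n]) (hk₁ : k ≡ k₁ [MOD m]) (hk₂ : k ≡ k₂ [MOD n]) :
    ω (m * n) ^ (a * k) = ω m ^ (i * k₁) * ω n ^ (j * k₂) := by
  rw [ω_pow_congr (mul_ne_zero hm hn) (ha.mul_right k),
    show (i * n + j * m) * k = n * (i * k) + m * (j * k) by ring, pow_add, pow_mul _ n, pow_mul _ m,
    ω_mul_pow_right m n hn, ω_mul_pow_left m n hm, ω_pow_congr hm (hk₁.mul_left i),
    ω_pow_congr hn (hk₂.mul_left j)]

theorem permMat_mul_mul_transpose_apply {n : ℕ} (γ υ : Equiv.Perm (Fin n))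
    (K : Matrix (Fin n) (Fin n) ℂ) (a b : Fin n) :
    (permMat γ * K * (permMat υ)ᵀ) a b = K (γ.symm a) (υ.symm b) := by
  simp [Matrix.mul_apply, permMat, ← Equiv.symm_apply_eq]

theorem Nat.ModEq.of_good_thomas {m n i j i' j' : ℕ} (hco : m.Coprime n)
    (h : i * n + j * m ≡ i' * n + j' * m [MOD m * n]) : i ≡ i' [MOD m] := by
  have h' := h.of_mul_right n
  simp only [Nat.ModEq, Nat.add_mul_mod_self_right] at h'
  exact Nat.ModEq.cancel_right_of_coprime hco h'

/-- Good–Thomas (prime factor) index mapping: for coprime `n₁, n₂` and `n = n₁·n₂`,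
`π(j₁,j₂) = (j₁·n₂ + j₂·n₁) mod n` and the CRT map `ρ` are bijections satisfying
`ω_n^{π(j₁,j₂)·ρ(k₁,k₂)} = ω_{n₁}^{j₁·k₁} · ω_{n₂}^{j₂·k₂}`; consequently there exist
permutation matrices `Γ, Υ` with `F_n = Γ · (F_{n₂} ⊗ F_{n₁}) · Υᵀ`. -/
theorem stmt12 (n₁ n₂ : ℕ) (h₁ : 1 ≤ n₁) (h₂ : 1 ≤ n₂) (hco : Nat.Coprime n₁ n₂)
    (π ρ : Fin n₁ × Fin n₂ → Fin (n₁ * n₂))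
    (hπ : ∀ p, (π p).val = (p.1.val * n₂ + p.2.val * n₁) % (n₁ * n₂))
    (hρ : ∀ p, (ρ p).val % n₁ = p.1.val ∧ (ρ p).val % n₂ = p.2.val) :
    Function.Bijective π ∧ Function.Bijective ρ ∧
    (∀ (j₁ k₁ : Fin n₁) (j₂ k₂ : Fin n₂),
        ω (n₁ * n₂) ^ ((π (j₁, j₂)).val * (ρ (k₁, k₂)).val)
          = ω n₁ ^ (j₁.val * k₁.val) * ω n₂ ^ (j₂.val * k₂.val)) ∧
    ∀ e : Fin (n₁ * n₂) ≃ Fin n₂ × Fin n₁,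
      ∃ γ υ : Equiv.Perm (Fin (n₁ * n₂)),
        dftMatrix (n₁ * n₂)
          = permMat γ * kronE e (dftMatrix n₂) (dftMatrix n₁) * (permMat υ)ᵀ := by
  have hn₁ : n₁ ≠ 0 := by omega
  have hn₂ : n₂ ≠ 0 := by omega
  have hcard : Fintype.card (Fin n₁ × Fin n₂) = Fintype.card (Fin (n₁ * n₂)) := by simp
  have hπ' : ∀ p, (π p).val ≡ p.1.val * n₂ + p.2.val * n₁ [MOD n₁ * n₂] := fun p => by
    rw [hπ p]; exact Nat.mod_modEq _ _
  have hπb : Function.Bijective π := by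
    refine (Fintype.bijective_iff_injective_and_card π).mpr ⟨fun p q hpq => ?_, hcard⟩
    have h : p.1.val * n₂ + p.2.val * n₁ ≡ q.1.val * n₂ + q.2.val * n₁ [MOD n₁ * n₂] :=
      (hπ' p).symm.trans (hpq ▸ hπ' q)
    have h' : p.2.val * n₁ + p.1.val * n₂ ≡ q.2.val * n₁ + q.1.val * n₂ [MOD n₂ * n₁] := by
      rwa [add_comm, add_comm (q.2.val * n₁), mul_comm n₂]
    exact Prod.ext
      (Fin.ext ((Nat.ModEq.of_good_thomas hco h).eq_of_lt_of_lt p.1.isLt q.1.isLt))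
      (Fin.ext ((Nat.ModEq.of_good_thomas hco.symm h').eq_of_lt_of_lt p.2.isLt q.2.isLt))
  have hρb : Function.Bijective ρ := by
    refine (Fintype.bijective_iff_injective_and_card ρ).mpr ⟨fun p q hpq => ?_, hcard⟩
    exact Prod.ext (Fin.ext (by rw [← (hρ p).1, ← (hρ q).1, hpq]))
      (Fin.ext (by rw [← (hρ p).2, ← (hρ q).2, hpq]))
  have key : ∀ p q : Fin n₁ × Fin n₂, ω (n₁ * n₂) ^ ((π p).val * (ρ q).val)
      = ω n₁ ^ (p.1.val * q.1.val) * ω n₂ ^ (p.2.val * q.2.val) := fun p q =>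
    ω_mul_pow_good_thomas hn₁ hn₂ (hπ' p)
      ((hρ q).1.trans (Nat.mod_eq_of_lt q.1.isLt).symm)
      ((hρ q).2.trans (Nat.mod_eq_of_lt q.2.isLt).symm)
  refine ⟨hπb, hρb, fun j₁ k₁ j₂ k₂ => key (j₁, j₂) (k₁, k₂), fun e => ?_⟩
  let ψ := e.trans (Equiv.prodComm (Fin n₂) (Fin n₁))
  refine ⟨ψ.trans (Equiv.ofBijective π hπb), ψ.trans (Equiv.ofBijective ρ hρb), ?_⟩
  ext a b
  obtain ⟨p, rfl⟩ := hπb.surjective a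
  obtain ⟨q, rfl⟩ := hρb.surjective b
  rw [permMat_mul_mul_transpose_apply]
  simp [ψ, kronE, dftMatrix, key, mul_comm]
end

section
/- The index-reversal permutation is digit reversal: let r ≥ 2, t ≥ 1 and n = r^t. For m a power of r, let R_{r,m} be the m×m permutation matrix determined by (R_{r,m}·x)(d + (m/r)·c) = x(c + r·d) for 0 ≤ c < r, 0 ≤ d < m/r, and for 1 ≤ q ≤ t let R^{(q)} be the n×n block-diagonal matrix consisting of r^{q−1} copies of R_{r, n/r^{q−1}}. Then the product P := R^{(t)} · R^{(t−1)} · ⋯ · R^{(1)} equals the permutation matrix of the base-r digit-reversal map ρ on {0,…,n−1}, defined by ρ(Σ_{i<t} d_i·rⁱ) = Σ_{i<t} d_{t−1−i}·rⁱ for digits 0 ≤ d_i < r. In particular P = Pᵀ and P · P = I_n. -/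
open Matrix Complex

/-- The `n × n` block-diagonal matrix consisting of `n/k` copies of the `k × k` matrix
given entrywise by `M`: entry `(s·k + a, s'·k + a') = M a a'` if `s = s'`, else `0`. -/
noncomputable def blockDiag (n k : ℕ) (M : ℕ → ℕ → ℂ) : Matrix (Fin n) (Fin n) ℂ :=
  fun x y => if x.val / k = y.val / k then M (x.val % k) (y.val % k) else 0

/-- Entries of the modulo-`r` sort permutation matrix `R_{r,m}`, determined by
`(R_{r,m}·x)(d + (m/r)·c) = x(c + r·d)` for `0 ≤ c < r`, `0 ≤ d < m/r`. -/
noncomputable def modSortFun (r m : ℕ) : ℕ → ℕ → ℂ :=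
  fun j k => if k = j / (m / r) + r * (j % (m / r)) then 1 else 0

/-- The base-`r` digit-reversal map on `t` digits:
`ρ(Σ_{i<t} d_i·rⁱ) = Σ_{i<t} d_{t−1−i}·rⁱ`. -/
def digitRev (r t j : ℕ) : ℕ :=
  ∑ i ∈ Finset.range t, (j / r ^ i % r) * r ^ (t - 1 - i)

theorem digitRev_succ (r s x : ℕ) :
    digitRev r (s + 1) x = x % r * r ^ s + digitRev r s (x / r) := by
  unfold digitRev
  rw [Finset.sum_range_succ', add_comm]
  congr 1
  · simp
  · refine Finset.sum_congr rfl fun i _ => ?_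
    rw [pow_succ', Nat.div_div_eq_div_mul]
    congr 2
    omega

theorem digitRev_succ' (r s x : ℕ) :
    digitRev r (s + 1) x = r * digitRev r s x + x / r ^ s % r := by
  unfold digitRev
  rw [Finset.sum_range_succ, Finset.mul_sum]
  congr 1
  · refine Finset.sum_congr rfl fun i hi => ?_
    have hi' := Finset.mem_range.1 hi
    rw [show s + 1 - 1 - i = (s - 1 - i) + 1 by omega, pow_succ]
    ring
  · simp

theorem digitRev_lt {r : ℕ} (hr : 0 < r) (s x : ℕ) : digitRev r s x < r ^ s := by
  induction s generalizing x with
  | zero => simp [digitRev]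
  | succ s ih =>
    rw [digitRev_succ, pow_succ']
    have h := ih (x / r)
    have h' := Nat.mul_le_mul_right (r ^ s) (Nat.succ_le_of_lt (Nat.mod_lt x hr))
    rw [Nat.succ_mul] at h'
    omega

theorem digitRev_mul_pow_add {r : ℕ} (hr : 0 < r) (s a b : ℕ) :
    digitRev r s (a * r ^ s + b) = digitRev r s b := by
  induction s generalizing b with
  | zero => simp [digitRev]
  | succ s ih =>
    have h : a * r ^ (s + 1) + b = b + r * (a * r ^ s) := by ring
    rw [digitRev_succ, digitRev_succ r s b, h, Nat.add_mul_mod_self_left,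
      Nat.add_mul_div_left _ _ hr, add_comm (b / r), ih]

theorem digitRev_digitRev {r : ℕ} (hr : 0 < r) {s x : ℕ} (hx : x < r ^ s) :
    digitRev r s (digitRev r s x) = x := by
  induction s generalizing x with
  | zero =>
    have : x = 0 := by simpa using hx
    simp [digitRev, this]
  | succ s ih =>
    have hdiv : x / r < r ^ s := Nat.div_lt_of_lt_mul (by rwa [← pow_succ'])
    rw [digitRev_succ r s x, digitRev_succ', digitRev_mul_pow_add hr, ih hdiv,
      mul_comm (x % r), Nat.mul_add_div (by positivity),
      Nat.div_eq_of_lt (digitRev_lt hr s _), add_zero, Nat.mod_mod, Nat.div_add_mod]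

/-- The column index of the nonzero entry in row `j` of the block-diagonal matrix with
blocks `R_{r,m}`. -/
def blockSort (r m j : ℕ) : ℕ :=
  m * (j / m) + (j % m / (m / r) + r * (j % m % (m / r)))

theorem modSort_lt {r u b : ℕ} (hr : 0 < r) (hb : b < r ^ (u + 1)) :
    b / r ^ u + r * (b % r ^ u) < r ^ (u + 1) := by
  have h1 : b / r ^ u < r := Nat.div_lt_of_lt_mul (by rwa [← pow_succ])
  have h2 : b % r ^ u + 1 ≤ r ^ u := Nat.mod_lt _ (by positivity)
  have h3 := Nat.mul_le_mul_left r h2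
  rw [pow_succ']
  rw [mul_add] at h3
  omega

theorem pow_succ_div_self {r : ℕ} (hr : 0 < r) (u : ℕ) : r ^ (u + 1) / r = r ^ u := by
  rw [pow_succ, Nat.mul_div_cancel _ hr]

theorem blockSort_div {r : ℕ} (hr : 0 < r) (u j : ℕ) :
    blockSort r (r ^ (u + 1)) j / r ^ (u + 1) = j / r ^ (u + 1) := by
  have hm : 0 < r ^ (u + 1) := by positivity
  rw [blockSort, pow_succ_div_self hr, Nat.mul_add_div hm,
    Nat.div_eq_of_lt (modSort_lt hr (Nat.mod_lt _ hm)), add_zero]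

theorem blockSort_mod {r : ℕ} (hr : 0 < r) (u j : ℕ) :
    blockSort r (r ^ (u + 1)) j % r ^ (u + 1) =
      j % r ^ (u + 1) / r ^ u + r * (j % r ^ (u + 1) % r ^ u) := by
  have hm : 0 < r ^ (u + 1) := by positivity
  rw [blockSort, pow_succ_div_self hr, Nat.mul_add_mod,
    Nat.mod_eq_of_lt (modSort_lt hr (Nat.mod_lt _ hm))]

theorem blockSort_lt {r : ℕ} (hr : 0 < r) {u s j : ℕ} (hj : j < r ^ (u + 1 + s)) :
    blockSort r (r ^ (u + 1)) j < r ^ (u + 1 + s) := by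
  have hm : 0 < r ^ (u + 1) := by positivity
  rw [pow_add r (u + 1) s, mul_comm] at hj ⊢
  rwa [← Nat.div_lt_iff_lt_mul hm, blockSort_div hr, Nat.div_lt_iff_lt_mul hm]

theorem blockDiag_modSortFun_apply {r n : ℕ} (hr : 0 < r) (u : ℕ) (j k : Fin n) :
    blockDiag n (r ^ (u + 1)) (modSortFun r (r ^ (u + 1))) j k =
      if k.val = blockSort r (r ^ (u + 1)) j.val then 1 else 0 := by
  have key : k.val = blockSort r (r ^ (u + 1)) j.val ↔
      j.val / r ^ (u + 1) = k.val / r ^ (u + 1) ∧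
        k.val % r ^ (u + 1) = j.val % r ^ (u + 1) / r ^ u +
          r * (j.val % r ^ (u + 1) % r ^ u) := by
    constructor
    · intro h
      rw [h, blockSort_div hr, blockSort_mod hr]
      exact ⟨rfl, rfl⟩
    · rintro ⟨h1, h2⟩
      rw [blockSort, pow_succ_div_self hr, ← h2, h1, Nat.div_add_mod]
  simp only [_root_.blockDiag, modSortFun, pow_succ_div_self hr, key, ite_and]

/-- Moving the leading digit of the low part to its end advances the partial reversal of
the leading digits by one step. -/
theorem partialRev_blockSort {r : ℕ} (hr : 0 < r) (u s j : ℕ) :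
    blockSort r (r ^ (u + 1)) j % r ^ (u + 1) * r ^ s +
        digitRev r s (blockSort r (r ^ (u + 1)) j / r ^ (u + 1)) =
      j % r ^ u * r ^ (s + 1) + digitRev r (s + 1) (j / r ^ u) := by
  rw [blockSort_div hr, blockSort_mod hr, digitRev_succ, Nat.div_div_eq_div_mul, ← pow_succ,
    Nat.mod_mod_of_dvd _ (pow_dvd_pow r u.le_succ), pow_succ r u, Nat.mod_mul_right_div_self]
  ring

theorem prod_blockDiag_apply {r t : ℕ} (hr : 0 < r) (s : ℕ) (hs : s ≤ t)
    (j k : Fin (r ^ t)) :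
    ((List.range s).reverse.map (fun q =>
        blockDiag (r ^ t) (r ^ t / r ^ q) (modSortFun r (r ^ t / r ^ q)))).prod j k =
      if k.val = j.val % r ^ (t - s) * r ^ s + digitRev r s (j.val / r ^ (t - s))
        then 1 else 0 := by
  induction s generalizing j with
  | zero =>
    simp [digitRev, Matrix.one_apply, Nat.mod_eq_of_lt j.isLt, Fin.ext_iff, eq_comm]
  | succ s ih =>
    obtain ⟨u, rfl⟩ : ∃ u, t = u + 1 + s := ⟨t - s - 1, by omega⟩
    have hdiv : r ^ (u + 1 + s) / r ^ s = r ^ (u + 1) := by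
      rw [pow_add, Nat.mul_div_cancel _ (by positivity)]
    have ih' := ih (by omega) ⟨_, blockSort_lt hr j.isLt⟩
    rw [show u + 1 + s - s = u + 1 by omega] at ih'
    simp only [partialRev_blockSort hr] at ih'
    rw [List.range_succ, List.reverse_append, List.reverse_singleton, List.singleton_append,
      List.map_cons, List.prod_cons, Matrix.mul_apply, hdiv,
      Finset.sum_eq_single ⟨_, blockSort_lt hr j.isLt⟩, ih', blockDiag_modSortFun_apply hr,
      show u + 1 + s - (s + 1) = u by omega]
    · simp
    · intro l _ hl
      rw [blockDiag_modSortFun_apply hr, if_neg (fun h => hl (Fin.ext h)), zero_mul]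
    · simp

/-- The index-reversal permutation is digit reversal: for `n = r^t`, the product
`P = R^{(t)} ⋯ R^{(1)}` of the block-diagonal modulo-`r` sort stages equals the permutation
matrix of the base-`r` digit-reversal map; in particular `P = Pᵀ` and `P·P = I`. -/
theorem stmt15 (r t : ℕ) (hr : 2 ≤ r) (ht : 1 ≤ t)
    (P : Matrix (Fin (r ^ t)) (Fin (r ^ t)) ℂ)
    (hP : P = ((List.range t).reverse.map (fun q =>
        blockDiag (r ^ t) (r ^ t / r ^ q) (modSortFun r (r ^ t / r ^ q)))).prod) :
    (∀ j k : Fin (r ^ t), P j k = if j.val = digitRev r t k.val then 1 else 0) ∧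
    P = Pᵀ ∧ P * P = 1 := by
  have hr0 : 0 < r := by omega
  have hrev : ∀ j k : Fin (r ^ t), k.val = digitRev r t j.val ↔ j.val = digitRev r t k.val := by
    intro j k
    constructor <;> intro h <;> rw [h, digitRev_digitRev hr0 (Fin.isLt _)]
  have hrow : ∀ j k : Fin (r ^ t), P j k = if k.val = digitRev r t j.val then 1 else 0 := by
    intro j k
    rw [hP, prod_blockDiag_apply hr0 t le_rfl]
    simp [Nat.mod_one]
  have hcol : ∀ j k : Fin (r ^ t), P j k = if j.val = digitRev r t k.val then 1 else 0 := by
    intro j k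
    simp only [hrow, hrev]
  refine ⟨hcol, ?_, ?_⟩
  · ext j k
    rw [Matrix.transpose_apply, hrow, hcol]
  · ext j k
    rw [Matrix.mul_apply, Finset.sum_eq_single ⟨_, digitRev_lt hr0 t j.val⟩, hrow, hrow,
      digitRev_digitRev hr0 j.isLt]
    · simp [Matrix.one_apply, Fin.ext_iff, eq_comm]
    · intro l _ hl
      rw [hrow, if_neg (fun h => hl (Fin.ext h)), zero_mul]
    · simp
end
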